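/- Suppose X = (X_u)_{u∈V_2} is an allocation to V_2 satisfying (P2), where n ≥ 2. Then there exists a PROPavg allocation of M to N. Specifically, if u* ∈ V_2 maximizes v_n(X_u) over u ∈ V_2, and the bundles (X_u)_{u∈V_2∖{u*}} are assigned to agents 1,…,n−1 according to a perfect matching in G_X − u* while agent n receives X_{u*}, then the resulting allocation to N is PROPavg. -/

import Mathlib

open Finset
open scoped Classical

noncomputable section

variable {G : Type*}

/-- Value of a bundle under an additive valuation. -/
def val (v : G → ℝ) (S : Finset G) : ℝ := ∑ g ∈ S, v g

/-- Minimum value of a good in a bundle; `0` for the empty bundle. -/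
def minval (v : G → ℝ) (S : Finset G) : ℝ :=
  if h : S.Nonempty then S.inf' h v else 0

/-- `X` is a partition of the goods into `n` pairwise disjoint (possibly empty) bundles. -/
def IsAlloc {n : ℕ} (X : Fin n → Finset G) : Prop :=
  (∀ i j : Fin n, i ≠ j → Disjoint (X i) (X j)) ∧ (∀ g : G, ∃ i : Fin n, g ∈ X i)

/-- Agent `i` is PROPavg-satisfied by the allocation `X`. -/
def PROPavgSat {n : ℕ} (v : Fin n → G → ℝ) (X : Fin n → Finset G) (i : Fin n) : Prop :=
  val (v i) (X i) + (1 / ((n : ℝ) - 1)) * ∑ k ∈ Finset.univ.erase i, minval (v i) (X k)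
    ≥ 1 / (n : ℝ)

/-- Edge of the PROPavg-graph between agent `i ∈ V₁` and label `u ∈ V₂` (both parts
are indexed by `Fin n`, `r` is the distinguished element of `V₂`). -/
def Edge {n : ℕ} (v : Fin n → G → ℝ) (X : Fin n → Finset G) (r i u : Fin n) : Prop :=
  val (v i) (X u) + (1 / ((n : ℝ) - 1)) *
      ∑ u' ∈ (Finset.univ.erase r).erase u, minval (v i) (X u')
    ≥ 1 / (n : ℝ)

/-- `i` is one of the agents `1, …, n-1`, i.e. not the last agent. -/
def InV1 {n : ℕ} (i : Fin n) : Prop := (i : ℕ) < n - 1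

/-- The set `V₁` of the first `n-1` agents. -/
def V1 (n : ℕ) : Finset (Fin n) := Finset.univ.filter fun i => (i : ℕ) < n - 1

/-- A perfect matching of `V₁` onto `V₂ \ {u}` in the PROPavg-graph `G_X`,
i.e. a bijection from `V₁` to `V₂ \ {u}` all of whose pairs are edges. -/
def IsPM {n : ℕ} (v : Fin n → G → ℝ) (X : Fin n → Finset G) (r u : Fin n)
    (f : Fin n → Fin n) : Prop :=
  Set.InjOn f {i : Fin n | InV1 i} ∧
  (∀ i : Fin n, InV1 i → f i ≠ u ∧ Edge v X r i (f i)) ∧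
  (∀ w : Fin n, w ≠ u → ∃ i : Fin n, InV1 i ∧ f i = w)

/-- Property (P1): `G_X - r` has a perfect matching. -/
def P1 {n : ℕ} (v : Fin n → G → ℝ) (X : Fin n → Finset G) (r : Fin n) : Prop :=
  ∃ f : Fin n → Fin n, IsPM v X r r f

/-- Property (P2): for every `u ∈ V₂`, `G_X - u` has a perfect matching. -/
def P2 {n : ℕ} (v : Fin n → G → ℝ) (X : Fin n → Finset G) (r : Fin n) : Prop :=
  ∀ u : Fin n, ∃ f : Fin n → Fin n, IsPM v X r u f

/-- The neighborhood `Γ_{G_X}(S) ⊆ V₂` of a set `S ⊆ V₁` in the PROPavg-graph. -/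
def Nbr {n : ℕ} (v : Fin n → G → ℝ) (X : Fin n → Finset G) (r : Fin n)
    (S : Finset (Fin n)) : Finset (Fin n) :=
  Finset.univ.filter fun u => ∃ i ∈ S, Edge v X r i u

/-- The allocation obtained from `X` by moving the good `g ∈ X ustar` to `X r`. -/
def move {n : ℕ} [DecidableEq G] (X : Fin n → Finset G) (r ustar : Fin n) (g : G) :
    Fin n → Finset G :=
  fun u => if u = r then insert g (X r) else if u = ustar then (X ustar).erase g else X u

/-- The map giving each agent of `V₁` its matched label and the last agent `ustar`. -/
def assign {n : ℕ} (ustar : Fin n) (f : Fin n → Fin n) (i : Fin n) : Fin n :=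
  if InV1 i then f i else ustar

theorem IsPM.assign_bijective {G : Type*} {n : ℕ} {v : Fin n → G → ℝ} {X : Fin n → Finset G}
    {r ustar : Fin n} {f : Fin n → Fin n} (hf : IsPM v X r ustar f) :
    Function.Bijective (assign ustar f) := by
  obtain ⟨hinj, hedge, -⟩ := hf
  refine Finite.injective_iff_bijective.mp fun i j hij => ?_
  by_cases hi : InV1 i <;> by_cases hj : InV1 j <;>
    simp only [assign, hi, hj, if_true, if_false] at hij
  · exact hinj hi hj hij
  · exact absurd hij (hedge i hi).1
  · exact absurd hij.symm (hedge j hj).1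
  · unfold InV1 at hi hj
    ext
    omega

theorem minval_nonneg {G : Type*} {v : G → ℝ} (hv : ∀ g, 0 ≤ v g) (S : Finset G) :
    0 ≤ minval v S := by
  unfold minval
  split_ifs with h
  · exact Finset.le_inf' _ _ fun g _ => hv g
  · exact le_rfl

theorem IsAlloc.comp_bijective {G : Type*} {n : ℕ} {X : Fin n → Finset G} (hX : IsAlloc X)
    {e : Fin n → Fin n} (he : Function.Bijective e) : IsAlloc (fun i => X (e i)) := by
  refine ⟨fun i j hij => hX.1 _ _ (he.1.ne hij), fun g => ?_⟩
  obtain ⟨u, hu⟩ := hX.2 g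
  obtain ⟨i, rfl⟩ := he.2 u
  exact ⟨i, hu⟩

theorem IsAlloc.sum_val {G : Type*} [Fintype G] {n : ℕ} {X : Fin n → Finset G} (hX : IsAlloc X)
    (v : G → ℝ) : ∑ u, val v (X u) = val v Finset.univ := by
  have hunion : Finset.univ.biUnion X = Finset.univ := by
    ext g
    simpa using hX.2 g
  unfold _root_.val
  rw [← hunion, Finset.sum_biUnion fun i _ j _ hij => hX.1 i j hij]

theorem sum_erase_comp_bijective {n : ℕ} {e : Fin n → Fin n} (he : Function.Bijective e)
    (a : Fin n → ℝ) (i : Fin n) :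
    ∑ k ∈ Finset.univ.erase i, a (e k) = ∑ u ∈ Finset.univ.erase (e i), a u := by
  have h₁ := Finset.add_sum_erase Finset.univ (fun k => a (e k)) (Finset.mem_univ i)
  have h₂ := Finset.add_sum_erase Finset.univ a (Finset.mem_univ (e i))
  have h₃ := he.sum_comp a
  linarith

theorem PROPavgSat.of_edge {G : Type*} {n : ℕ} (hn : 2 ≤ n) {v : Fin n → G → ℝ}
    {X : Fin n → Finset G} {r : Fin n} {i : Fin n} (hpos : ∀ g, 0 ≤ v i g)
    {e : Fin n → Fin n} (he : Function.Bijective e) (hedge : Edge v X r i (e i)) :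
    PROPavgSat v (fun i => X (e i)) i := by
  have hn' : (0 : ℝ) ≤ 1 / ((n : ℝ) - 1) :=
    one_div_nonneg.mpr (by have : (2 : ℝ) ≤ n := by exact_mod_cast hn
                           linarith)
  have hsub : ∑ u ∈ (Finset.univ.erase r).erase (e i), minval (v i) (X u)
      ≤ ∑ u ∈ Finset.univ.erase (e i), minval (v i) (X u) :=
    Finset.sum_le_sum_of_subset_of_nonneg
      (Finset.erase_subset_erase _ (Finset.erase_subset _ _))
      fun u _ _ => minval_nonneg hpos (X u)
  unfold PROPavgSat
  unfold Edge at hedge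
  rw [sum_erase_comp_bijective he (fun u => minval (v i) (X u))]
  exact hedge.trans (by gcongr)

theorem PROPavgSat.of_val_ge {G : Type*} {n : ℕ} (hn : 2 ≤ n) {v : Fin n → G → ℝ}
    {Y : Fin n → Finset G} {i : Fin n} (hpos : ∀ g, 0 ≤ v i g)
    (hval : 1 / (n : ℝ) ≤ val (v i) (Y i)) : PROPavgSat v Y i := by
  have hn' : (0 : ℝ) ≤ 1 / ((n : ℝ) - 1) :=
    one_div_nonneg.mpr (by have : (2 : ℝ) ≤ n := by exact_mod_cast hn
                           linarith)
  exact hval.trans (le_add_of_nonneg_right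
    (mul_nonneg hn' (Finset.sum_nonneg fun k _ => minval_nonneg hpos (Y k))))

theorem IsAlloc.one_div_le_val_of_max {G : Type*} [Fintype G] {n : ℕ} {X : Fin n → Finset G}
    (hX : IsAlloc X) {v : G → ℝ} (hnorm : val v Finset.univ = 1) {u : Fin n}
    (hmax : ∀ w, val v (X w) ≤ val v (X u)) : 1 / (n : ℝ) ≤ val v (X u) := by
  have hn : (0 : ℝ) < n := by exact_mod_cast u.pos
  have h := Finset.sum_le_sum fun w (_ : w ∈ Finset.univ) => hmax w
  rw [hX.sum_val, hnorm, Finset.sum_const, Finset.card_univ, Fintype.card_fin, nsmul_eq_mul] at h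
  rwa [div_le_iff₀' hn]

/-- Lemma 3: from an allocation to `V₂` satisfying (P2), letting the
last agent pick a best bundle `X ustar` and matching the remaining bundles to the
first `n-1` agents by a perfect matching of `G_X - ustar` gives a PROPavg allocation;
in particular a PROPavg allocation of `M` to `N` exists. -/
theorem p2_gives_propavg {G : Type*} [Fintype G] (n : ℕ) (hn : 2 ≤ n)
    (v : Fin n → G → ℝ) (X : Fin n → Finset G) (r : Fin n)
    (hpos : ∀ (i : Fin n) (g : G), 0 ≤ v i g)
    (hnorm : ∀ i : Fin n, val (v i) (Finset.univ : Finset G) = 1)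
    (hX : IsAlloc X)
    (hP2 : P2 v X r)
    (ustar : Fin n)
    (hmax : ∀ u : Fin n,
      val (v (⟨n - 1, by omega⟩ : Fin n)) (X u)
        ≤ val (v (⟨n - 1, by omega⟩ : Fin n)) (X ustar))
    (f : Fin n → Fin n) (hf : IsPM v X r ustar f) :
    (∃ Y : Fin n → Finset G, IsAlloc Y ∧ ∀ i : Fin n, PROPavgSat v Y i) ∧
    (∀ i : Fin n, PROPavgSat v (fun i => if InV1 i then X (f i) else X ustar) i) := by
  have he := hf.assign_bijective
  have hassign : (fun i => if InV1 i then X (f i) else X ustar)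
      = fun i => X (assign ustar f i) := by
    funext i
    exact (apply_ite X _ _ _).symm
  rw [hassign]
  have hsat : ∀ i, PROPavgSat v (fun i => X (assign ustar f i)) i := by
    intro i
    by_cases hi : InV1 i
    · refine PROPavgSat.of_edge (r := r) hn (hpos i) he ?_
      rw [assign, if_pos hi]
      exact (hf.2.1 i hi).2
    · refine PROPavgSat.of_val_ge hn (hpos i) ?_
      have hlast : i = ⟨n - 1, by omega⟩ := by
        unfold InV1 at hi
        ext
        simp only
        omega
      simp only [assign, if_neg hi]
      subst hlast
      exact hX.one_div_le_val_of_max (hnorm _) hmax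
  exact ⟨⟨_, hX.comp_bijective he, hsat⟩, hsat⟩
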